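/- If a multiplicative function f : ℕ → ℂ satisfies f(p+q-2) = f(p) + f(q) - f(2) for all primes p and q, and f(2) = 2, then f is the identity function: f(n) = n for all positive integers n. -/

import Mathlib

theorem factorial_dvd_pow_mul_prod_add_mul (a d n : ℕ) :
    n.factorial ∣ d ^ n * ∏ k ∈ Finset.range n, (a + k * d) := by
  rw [Nat.dvd_iff_prime_pow_dvd_dvd]
  intro p j hp hj
  by_cases hpd : p ∣ d
  · have h1 : j ≤ n := by
      rw [hp.pow_dvd_iff_le_factorization n.factorial_ne_zero] at hj
      exact hj.trans ((Nat.factorization_factorial_le_div_pred hp n).trans (Nat.div_le_self _ _))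
    exact Dvd.dvd.mul_right ((pow_dvd_pow p h1).trans (pow_dvd_pow_of_dvd hpd n)) _
  · apply Dvd.dvd.mul_left
    rcases Nat.eq_zero_or_pos j with rfl | hj0
    · simp
    have hcop : d.Coprime (p ^ j) :=
      Nat.Coprime.pow_right _ ((hp.coprime_iff_not_dvd.2 hpd).symm)
    obtain ⟨e, -, he⟩ := Nat.exists_mul_mod_eq_one_of_coprime hcop
      (Nat.one_lt_pow hj0.ne' hp.one_lt)
    have hde : d * e ≡ 1 [MOD p ^ j] := by
      rw [Nat.ModEq, he, Nat.mod_eq_of_lt (Nat.one_lt_pow hj0.ne' hp.one_lt)]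
    have hcope : (p ^ j).Coprime (e ^ n) := by
      apply Nat.Coprime.pow_right
      have h : Nat.Coprime (d * e) (p ^ j) := by
        rw [Nat.coprime_iff_gcd_eq_one, hde.gcd_eq]
        simp
      exact (Nat.Coprime.coprime_mul_left h).symm
    refine hcope.dvd_of_dvd_mul_right ?_
    have h2 : (∏ k ∈ Finset.range n, (a + k * d)) * e ^ n ≡
        ∏ k ∈ Finset.range n, (a * e + k) [MOD p ^ j] := by
      have h3 : (∏ k ∈ Finset.range n, (a + k * d)) * e ^ n =
          ∏ k ∈ Finset.range n, (a * e + k * (d * e)) := by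
        rw [← Finset.card_range n, ← Finset.prod_const, Finset.card_range,
          ← Finset.prod_mul_distrib]
        exact Finset.prod_congr rfl fun k _ => by ring
      rw [h3]
      refine Nat.ModEq.prod fun k _ => ?_
      simpa using (hde.mul_left k).add_left (a * e)
    rw [← Nat.ascFactorial_eq_prod_range] at h2
    exact (h2.dvd_iff dvd_rfl).2 (hj.trans (Nat.factorial_dvd_ascFactorial _ _))

/-- An elementary bound of Brun–Titchmarsh type: the logarithmic weight of the primes in a residue
class modulo a composite `d`, lying above `n` and below `n * d`, is at most `2 * n * log d`. -/
theorem sum_log_primes_modEq_le {d n : ℕ} {T : Finset ℕ} (hd : 0 < d) (hdp : ¬ d.Prime)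
    (hT : ∀ p ∈ T, p.Prime ∧ n < p ∧ p / d < n)
    (hcong : ∀ p ∈ T, ∀ q ∈ T, p ≡ q [MOD d]) :
    ∑ p ∈ T, Real.log p ≤ 2 * n * Real.log d := by
  rcases T.eq_empty_or_nonempty with rfl | ⟨p₀, hp₀⟩
  · have : 0 ≤ Real.log d := Real.log_natCast_nonneg d
    simp only [Finset.sum_empty]
    positivity
  set a := p₀ % d with ha
  have ha0 : 0 < a := by
    rw [Nat.pos_iff_ne_zero]
    intro h
    obtain ⟨hp, h1, h2⟩ := hT p₀ hp₀
    rcases (Nat.dvd_prime hp).1 (Nat.dvd_of_mod_eq_zero h) with h3 | h3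
    · rw [h3, Nat.div_one] at h2
      omega
    · exact hdp (h3 ▸ hp)
  have had : a < d := Nat.mod_lt _ hd
  set Q := ∏ k ∈ Finset.range n, (a + k * d) with hQ
  have hdvdQ : (∏ p ∈ T, p) ∣ Q := by
    refine Finset.prod_primes_dvd Q (fun p hp => (hT p hp).1.prime) fun p hp => ?_
    have h1 : a + (p / d) * d = p := by
      rw [ha, ← hcong p hp p₀ hp₀, mul_comm]
      exact Nat.mod_add_div p d
    have h2 := Finset.dvd_prod_of_mem (fun k => a + k * d)
      (Finset.mem_range.2 (hT p hp).2.2)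
    simpa only [h1] using h2
  have hcop : Nat.Coprime (∏ p ∈ T, p) n.factorial := by
    refine Nat.Coprime.prod_left fun p hp => ?_
    rw [(hT p hp).1.coprime_iff_not_dvd, (hT p hp).1.dvd_factorial]
    exact not_le.2 (hT p hp).2.1
  have hQle : Q ≤ d ^ n * n.factorial := by
    rw [hQ, ← Finset.prod_range_add_one_eq_factorial]
    calc _ ≤ ∏ k ∈ Finset.range n, d * (k + 1) :=
          Finset.prod_le_prod' fun k _ => by nlinarith
      _ = _ := by rw [Finset.prod_mul_distrib, Finset.prod_const, Finset.card_range]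
  have hQpos : 0 < Q := Finset.prod_pos fun k _ => by positivity
  have hle : (∏ p ∈ T, p) * n.factorial ≤ d ^ n * (d ^ n * n.factorial) :=
    (Nat.le_of_dvd (by positivity) (hcop.mul_dvd_of_dvd_of_dvd (hdvdQ.mul_left _)
      (factorial_dvd_pow_mul_prod_add_mul a d n))).trans (Nat.mul_le_mul_left _ hQle)
  have hle' : (∏ p ∈ T, p) ≤ d ^ n * d ^ n := by
    rw [← mul_assoc] at hle
    exact Nat.le_of_mul_le_mul_right hle n.factorial_pos
  have hTpos : 0 < ∏ p ∈ T, p := Finset.prod_pos fun p hp => (hT p hp).1.pos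
  calc ∑ p ∈ T, Real.log p = Real.log ((∏ p ∈ T, p : ℕ) : ℝ) := by
        rw [Nat.cast_prod, Real.log_prod]
        intro p hp
        exact_mod_cast (hT p hp).1.ne_zero
    _ ≤ Real.log ((d ^ n * d ^ n : ℕ) : ℝ) :=
        Real.log_le_log (by exact_mod_cast hTpos) (by exact_mod_cast hle')
    _ = 2 * n * Real.log d := by
        have : (d : ℝ) ≠ 0 := by positivity
        push_cast
        rw [Real.log_mul (by positivity) (by positivity), Real.log_pow]
        ring

/-- The least power of `r`, with exponent at least two, which is not smaller than `N`. -/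
def leastPow (N r : ℕ) : ℕ := r ^ max 2 (Nat.clog r N)

theorem le_leastPow {N r : ℕ} (hr : 2 ≤ r) : N ≤ leastPow N r :=
  (Nat.le_pow_clog hr N).trans (Nat.pow_le_pow_right (by omega) (le_max_right _ _))

theorem sq_le_leastPow {N r : ℕ} (hr : 2 ≤ r) : r ^ 2 ≤ leastPow N r :=
  Nat.pow_le_pow_right (by omega) (le_max_left _ _)

theorem leastPow_dvd_pow {N r k : ℕ} (hk : 2 ≤ k) (h : N ≤ r ^ k) : leastPow N r ∣ r ^ k :=
  pow_dvd_pow r (max_le hk (Nat.clog_le_of_le_pow h))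

theorem not_prime_leastPow_mul (N M : ℕ) {r : ℕ} (hr : 2 ≤ r) : ¬ (leastPow N r * M).Prime := by
  intro h
  have h2 : r * r ∣ leastPow N r * M := by
    rw [← sq]
    exact Dvd.dvd.mul_right (pow_dvd_pow r (le_max_left _ _)) _
  have h4 := Nat.isUnit_iff.1 (h.prime.squarefree r h2)
  omega

theorem sum_Icc_two_le_add {g : ℕ → ℝ} (hg : ∀ r, 0 ≤ g r) (R Y : ℕ) :
    ∑ r ∈ Finset.Icc 2 Y, g r ≤
      ∑ r ∈ Finset.Icc 2 R, g r + ∑ r ∈ Finset.Icc (R + 1) (max R Y), g r := by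
  have hsub : Finset.Icc 2 Y ⊆ Finset.Icc 2 R ∪ Finset.Icc (R + 1) (max R Y) := by
    intro r
    simp only [Finset.mem_Icc, Finset.mem_union]
    omega
  have hdisj : Disjoint (Finset.Icc 2 R) (Finset.Icc (R + 1) (max R Y)) := by
    rw [Finset.disjoint_left]
    intro r
    simp only [Finset.mem_Icc]
    omega
  rw [← Finset.sum_union hdisj]
  exact Finset.sum_le_sum_of_subset_of_nonneg hsub fun r _ _ => hg r

theorem sum_Icc_inv_sq_le {R Y : ℕ} (hR : 1 ≤ R) (hY : R ≤ Y) :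
    ∑ r ∈ Finset.Icc (R + 1) Y, 1 / (r : ℝ) ^ 2 ≤ 1 / (R : ℝ) - 1 / (Y : ℝ) := by
  induction Y, hY using Nat.le_induction with
  | base => simp
  | succ n hn ih =>
    rw [Finset.sum_Icc_succ_top (by omega)]
    have hn0 : (0 : ℝ) < n := by exact_mod_cast (by omega : 0 < n)
    have : 1 / ((n + 1 : ℕ) : ℝ) ^ 2 ≤ 1 / n - 1 / ((n + 1 : ℕ) : ℝ) := by
      push_cast
      rw [div_sub_div _ _ (by positivity) (by positivity), div_le_div_iff₀ (by positivity) (by positivity)]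
      nlinarith
    linarith

theorem sum_Icc_log_div_sq_le {R Y : ℕ} (hR : 4 ≤ R) (hY : R ≤ Y) :
    ∑ r ∈ Finset.Icc (R + 1) Y, Real.log r / (r : ℝ) ^ 2 ≤
      (Real.log R + 1) / R - (Real.log Y + 1) / Y := by
  induction Y, hY using Nat.le_induction with
  | base => simp
  | succ n hn ih =>
    rw [Finset.sum_Icc_succ_top (by omega)]
    have hn4 : (4 : ℝ) ≤ n := by exact_mod_cast (by omega : 4 ≤ n)
    have hn0 : (0 : ℝ) < n := by linarith
    have hlog : Real.log (n + 1) - 1 / n ≤ Real.log n := by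
      have h := Real.log_le_sub_one_of_pos (show 0 < ((n : ℝ) + 1) / n by positivity)
      rw [Real.log_div (by positivity) (by positivity)] at h
      have h2 : ((n : ℝ) + 1) / n - 1 = 1 / n := by field_simp; ring
      linarith
    have hlog2 : 5 / 4 ≤ Real.log (n + 1) := by
      have h4 : Real.log 4 ≤ Real.log (n + 1) := Real.log_le_log (by norm_num) (by linarith)
      have h2 : Real.log 4 = 2 * Real.log 2 := by
        rw [show (4 : ℝ) = 2 ^ 2 by norm_num, Real.log_pow]; norm_num
      linarith [Real.log_two_gt_d9]
    have key : Real.log ((n + 1 : ℕ) : ℝ) / ((n + 1 : ℕ) : ℝ) ^ 2 ≤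
        (Real.log n + 1) / n - (Real.log ((n + 1 : ℕ) : ℝ) + 1) / ((n + 1 : ℕ) : ℝ) := by
      push_cast
      have h1 : (Real.log (n + 1) - 1 / n + 1) / n ≤ (Real.log n + 1) / n := by gcongr
      refine le_trans ?_ (sub_le_sub_right h1 _)
      rw [← sub_nonneg]
      have h3 : (Real.log (n + 1) - 1 / n + 1) / n - (Real.log (n + 1) + 1) / (n + 1) -
          Real.log (n + 1) / (n + 1 : ℝ) ^ 2 =
          (Real.log (n + 1) * n - (n + 1)) / (n ^ 2 * (n + 1) ^ 2) := by
        field_simp; ring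
      rw [h3]
      apply div_nonneg _ (by positivity)
      nlinarith
    linarith

theorem sum_inv_leastPow_le {N R : ℕ} (hR : 1 ≤ R) (hRN : R ^ 2 ≤ N) (Y : ℕ) :
    ∑ r ∈ Finset.Icc 2 Y, 1 / (leastPow N r : ℝ) ≤ 2 / R := by
  have hR0 : (0 : ℝ) < R := by exact_mod_cast hR
  have hnn : ∀ r : ℕ, 0 ≤ 1 / (leastPow N r : ℝ) := fun r => by positivity
  have h1 : ∑ r ∈ Finset.Icc 2 R, 1 / (leastPow N r : ℝ) ≤ 1 / R := by
    calc _ ≤ ∑ r ∈ Finset.Icc 2 R, 1 / (R : ℝ) ^ 2 := by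
          refine Finset.sum_le_sum fun r hr => ?_
          have := hRN.trans (le_leastPow (N := N) (Finset.mem_Icc.1 hr).1)
          have h2 : (R : ℝ) ^ 2 ≤ leastPow N r := by exact_mod_cast this
          gcongr
      _ ≤ R * (1 / (R : ℝ) ^ 2) := by
          rw [Finset.sum_const, nsmul_eq_mul]
          gcongr
          simp
      _ = 1 / R := by field_simp
  have h2 : ∑ r ∈ Finset.Icc (R + 1) (max R Y), 1 / (leastPow N r : ℝ) ≤ 1 / R := by
    calc _ ≤ ∑ r ∈ Finset.Icc (R + 1) (max R Y), 1 / (r : ℝ) ^ 2 := by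
          refine Finset.sum_le_sum fun r hr => ?_
          have hr2 : 2 ≤ r := by have := (Finset.mem_Icc.1 hr).1; omega
          have h2 : (r : ℝ) ^ 2 ≤ leastPow N r := by exact_mod_cast sq_le_leastPow hr2
          gcongr
      _ ≤ _ := sum_Icc_inv_sq_le hR (le_max_left _ _)
      _ ≤ 1 / R := sub_le_self _ (by positivity)
  calc _ ≤ _ := sum_Icc_two_le_add hnn R Y
    _ ≤ 2 / R := by
        have : (2 : ℝ) / R = 1 / R + 1 / R := by ring
        linarith

theorem sum_log_leastPow_div_le {N R : ℕ} (hR : 4 ≤ R) (hRN : R ^ 2 ≤ N) (Y : ℕ) :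
    ∑ r ∈ Finset.Icc 2 Y, Real.log (leastPow N r) / (leastPow N r : ℝ) ≤
      (4 * Real.log R + 2) / R := by
  have hR0 : (0 : ℝ) < R := by exact_mod_cast (by omega : 0 < R)
  have hlogR : 0 ≤ Real.log R := Real.log_natCast_nonneg R
  have hnn : ∀ r : ℕ, 0 ≤ Real.log (leastPow N r) / (leastPow N r : ℝ) := fun r =>
    div_nonneg (Real.log_natCast_nonneg _) (Nat.cast_nonneg _)
  have hanti : ∀ m r : ℕ, 4 ≤ m → m ^ 2 ≤ leastPow N r →
      Real.log (leastPow N r) / (leastPow N r : ℝ) ≤ 2 * (Real.log m / (m : ℝ) ^ 2) := by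
    intro m r hm h
    have hm' : (4 : ℝ) ≤ m := by exact_mod_cast hm
    have h' : (m : ℝ) ^ 2 ≤ leastPow N r := by exact_mod_cast h
    have he : Real.exp 1 ≤ (m : ℝ) ^ 2 := by nlinarith [Real.exp_one_lt_d9]
    have := Real.log_div_self_antitoneOn (Set.mem_Ici.2 he) (Set.mem_Ici.2 (he.trans h')) h'
    simp only [Real.log_pow] at this
    push_cast at this
    linarith [mul_div_assoc 2 (Real.log m) ((m : ℝ) ^ 2)]
  have h1 : ∑ r ∈ Finset.Icc 2 R, Real.log (leastPow N r) / (leastPow N r : ℝ) ≤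
      2 * Real.log R / R := by
    calc _ ≤ ∑ r ∈ Finset.Icc 2 R, 2 * (Real.log R / (R : ℝ) ^ 2) :=
          Finset.sum_le_sum fun r hr =>
            hanti R r hR (hRN.trans (le_leastPow (Finset.mem_Icc.1 hr).1))
      _ ≤ R * (2 * (Real.log R / (R : ℝ) ^ 2)) := by
          rw [Finset.sum_const, nsmul_eq_mul]
          gcongr
          simp
      _ = _ := by field_simp
  have h2 : ∑ r ∈ Finset.Icc (R + 1) (max R Y), Real.log (leastPow N r) / (leastPow N r : ℝ) ≤
      2 * ((Real.log R + 1) / R) := by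
    calc _ ≤ ∑ r ∈ Finset.Icc (R + 1) (max R Y), 2 * (Real.log r / (r : ℝ) ^ 2) := by
          refine Finset.sum_le_sum fun r hr => ?_
          have := (Finset.mem_Icc.1 hr).1
          exact hanti r r (by omega) (sq_le_leastPow (by omega))
      _ ≤ _ := by
          rw [← Finset.mul_sum]
          gcongr
          refine (sum_Icc_log_div_sq_le hR (le_max_left _ _)).trans (sub_le_self _ ?_)
          have := Real.log_natCast_nonneg (max R Y)
          positivity
  calc _ ≤ _ := sum_Icc_two_le_add hnn R Y
    _ ≤ _ := by
        have : (4 * Real.log R + 2) / R = 2 * Real.log R / R + 2 * ((Real.log R + 1) / R) := by ring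
        linarith

theorem sum_log_primes_le_of_leastPow {N R M x Y Z : ℕ} (hR : 4 ≤ R) (hRN : R ^ 2 ≤ N)
    (hM : 0 < M) (P : ℕ → ℕ → Prop) (B : Finset ℕ)
    (hB : ∀ p ∈ B, p.Prime ∧ p ≤ x ∧ ∃ r ∈ Finset.Icc 2 Y, P r p)
    (hZ : ∀ r ∈ Finset.Icc 2 Y, ∀ p ∈ B, P r p → leastPow N r * M ≤ Z)
    (hcong : ∀ r ∈ Finset.Icc 2 Y, ∀ p ∈ B, ∀ q ∈ B, P r p → P r q →
      p ≡ q [MOD leastPow N r * M]) :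
    ∑ p ∈ B, Real.log p ≤ x / M * ((8 * Real.log R + 4 + 4 * Real.log M) / R) +
      2 * Y * Real.log Z + Real.log 4 * (x / (N * M) + 1) := by
  classical
  have hR0 : (0 : ℝ) < R := by exact_mod_cast (by omega : 0 < R)
  have hM0 : (0 : ℝ) < M := by exact_mod_cast hM
  have hN : 0 < N := lt_of_lt_of_le (by positivity) hRN
  set K := x / (N * M) + 1 with hK
  have hlog : ∀ p : ℕ, 0 ≤ Real.log p := fun p => Real.log_natCast_nonneg p
  have hsplit : ∑ p ∈ B, Real.log p ≤ ∑ p ∈ B with p ≤ K, Real.log p +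
      ∑ r ∈ Finset.Icc 2 Y, ∑ p ∈ B with K < p ∧ P r p, Real.log p := by
    simp_rw [Finset.sum_filter]
    rw [Finset.sum_comm, ← Finset.sum_add_distrib]
    refine Finset.sum_le_sum fun p hp => ?_
    have hnn : ∀ r ∈ Finset.Icc 2 Y, 0 ≤ if K < p ∧ P r p then Real.log p else 0 := by
      intro r _
      split_ifs
      exacts [hlog p, le_rfl]
    by_cases hpK : p ≤ K
    · rw [if_pos hpK]
      linarith [Finset.sum_nonneg hnn]
    · obtain ⟨-, -, r, hr, hPr⟩ := hB p hp
      rw [if_neg hpK, zero_add]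
      refine le_trans ?_ (Finset.single_le_sum hnn hr)
      rw [if_pos ⟨not_le.1 hpK, hPr⟩]
  have hsmall : ∑ p ∈ B with p ≤ K, Real.log p ≤ Real.log 4 * (x / (N * M) + 1) := by
    calc _ ≤ ∑ p ∈ K.primesLE, Real.log p := by
          refine Finset.sum_le_sum_of_subset_of_nonneg (fun p hp => ?_) fun p _ _ => hlog p
          rw [Finset.mem_filter] at hp
          exact Nat.mem_primesLE.2 ⟨hp.2, (hB p hp.1).1⟩
      _ = Chebyshev.theta K := (Chebyshev.theta_eq_sum_primesLE_log K).symm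
      _ ≤ Real.log 4 * K := Chebyshev.theta_le_log4_mul_x (Nat.cast_nonneg K)
      _ ≤ _ := by
          have h := @Nat.cast_div_le ℝ _ _ _ x (N * M)
          have : 0 ≤ Real.log 4 := Real.log_nonneg (by norm_num)
          rw [hK]
          push_cast at h ⊢
          gcongr
  have hclass : ∀ r ∈ Finset.Icc 2 Y, ∑ p ∈ B with K < p ∧ P r p, Real.log p ≤
      2 * (x / M) * (Real.log (leastPow N r) / leastPow N r) +
      2 * (x / M) * Real.log M * (1 / leastPow N r) + 2 * Real.log Z := by
    intro r hr
    have hr2 : 2 ≤ r := (Finset.mem_Icc.1 hr).1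
    set d := leastPow N r with hd
    have hNd : N ≤ d := le_leastPow hr2
    have hd0 : (0 : ℝ) < d := by exact_mod_cast hN.trans_le hNd
    rcases (B.filter fun p => K < p ∧ P r p).eq_empty_or_nonempty with he | ⟨p₀, hp₀⟩
    · have h1 := hlog d
      have h2 := hlog M
      have h3 := hlog Z
      rw [he, Finset.sum_empty]
      positivity
    · rw [Finset.mem_filter] at hp₀
      have hdZ := hZ r hr p₀ hp₀.1 hp₀.2.2
      have hdM : 0 < d * M := Nat.mul_pos (hN.trans_le hNd) hM
      have hnK : x / (d * M) + 1 ≤ K :=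
        Nat.succ_le_succ (Nat.div_le_div_left (Nat.mul_le_mul_right M hNd) (by positivity))
      have h := sum_log_primes_modEq_le (n := x / (d * M) + 1)
        (T := B.filter fun p => K < p ∧ P r p) hdM (not_prime_leastPow_mul N M hr2)
        (fun p hp => by
          rw [Finset.mem_filter] at hp
          obtain ⟨h1, h2, -⟩ := hB p hp.1
          exact ⟨h1, by omega, Nat.lt_succ_of_le (Nat.div_le_div_right h2)⟩)
        (fun p hp q hq => by
          rw [Finset.mem_filter] at hp hq
          exact hcong r hr p hp.1 q hq.1 hp.2.2 hq.2.2)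
      refine h.trans ?_
      have h1 : ((x / (d * M) + 1 : ℕ) : ℝ) ≤ x / (d * M) + 1 := by
        have h := @Nat.cast_div_le ℝ _ _ _ x (d * M)
        push_cast at h ⊢
        linarith
      have h2 : Real.log ((d * M : ℕ) : ℝ) ≤ Real.log Z :=
        Real.log_le_log (by exact_mod_cast hdM) (by exact_mod_cast hdZ)
      calc 2 * ((x / (d * M) + 1 : ℕ) : ℝ) * Real.log ((d * M : ℕ) : ℝ)
          ≤ 2 * (x / (d * M) + 1) * Real.log ((d * M : ℕ) : ℝ) := by
            gcongr
        _ = 2 * (x / (d * M)) * Real.log ((d * M : ℕ) : ℝ) +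
            2 * Real.log ((d * M : ℕ) : ℝ) := by ring
        _ ≤ 2 * (x / (d * M)) * Real.log ((d * M : ℕ) : ℝ) + 2 * Real.log Z := by linarith
        _ = _ := by
            push_cast
            rw [Real.log_mul hd0.ne' hM0.ne']
            field_simp
  have hsum := Finset.sum_le_sum hclass
  rw [Finset.sum_add_distrib, Finset.sum_add_distrib, ← Finset.mul_sum, ← Finset.mul_sum,
    Finset.sum_const, nsmul_eq_mul] at hsum
  have hA : 2 * ((x : ℝ) / M) *
      ∑ r ∈ Finset.Icc 2 Y, Real.log (leastPow N r) / (leastPow N r : ℝ) ≤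
      2 * (x / M) * ((4 * Real.log R + 2) / R) := by
    gcongr
    exact sum_log_leastPow_div_le hR hRN Y
  have hA' : 2 * ((x : ℝ) / M) * Real.log M *
      ∑ r ∈ Finset.Icc 2 Y, 1 / (leastPow N r : ℝ) ≤ 2 * (x / M) * Real.log M * (2 / R) := by
    have := hlog M
    gcongr
    exact sum_inv_leastPow_le (by omega) hRN Y
  have hcard : ((Finset.Icc 2 Y).card : ℝ) * (2 * Real.log Z) ≤ Y * (2 * Real.log Z) := by
    have := hlog Z
    gcongr
    simp
  have heq : x / M * ((8 * Real.log R + 4 + 4 * Real.log M) / R) =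
      2 * ((x : ℝ) / M) * ((4 * Real.log R + 2) / R) + 2 * (x / M) * Real.log M * (2 / R) := by
    ring
  rw [heq]
  linarith

theorem sum_range_mul_le_of_antitone {a w : ℕ → ℝ} {ε C : ℝ} (hw : Antitone w)
    (hw0 : ∀ n, 0 ≤ w n) (ha : ∀ n, ∑ k ∈ Finset.range n, a k ≤ ε * n + C) (n : ℕ) :
    ∑ k ∈ Finset.range n, a k * w k ≤ ε * ∑ k ∈ Finset.range n, w k + C * w 0 := by
  have key : ∑ k ∈ Finset.range n, (a k - ε) * w k ≤
      C * w 0 - (C - ∑ k ∈ Finset.range n, (a k - ε)) * w n := by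
    induction n with
    | zero => simp
    | succ n ih =>
      rw [Finset.sum_range_succ, Finset.sum_range_succ]
      have h1 : ∑ k ∈ Finset.range (n + 1), (a k - ε) ≤ C := by
        rw [Finset.sum_sub_distrib, Finset.sum_const, Finset.card_range, nsmul_eq_mul]
        linarith [ha (n + 1)]
      rw [Finset.sum_range_succ] at h1
      nlinarith [mul_nonneg (sub_nonneg.2 h1) (sub_nonneg.2 (hw n.le_succ))]
  have h1 : 0 ≤ C - ∑ k ∈ Finset.range n, (a k - ε) := by
    rw [Finset.sum_sub_distrib, Finset.sum_const, Finset.card_range, nsmul_eq_mul]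
    linarith [ha n]
  have h2 : ∑ k ∈ Finset.range n, (a k - ε) * w k =
      ∑ k ∈ Finset.range n, a k * w k - ε * ∑ k ∈ Finset.range n, w k := by
    rw [Finset.mul_sum, ← Finset.sum_sub_distrib]
    exact Finset.sum_congr rfl fun k _ => by ring
  nlinarith [mul_nonneg h1 (hw0 n)]

open Filter Topology ArithmeticFunction.vonMangoldt in
/-- If the logarithmic weight of the primes `p ≡ a` up to `n` is eventually at most `ε * n`, then
`ε` is at least the expected density. -/
theorem inv_totient_le_of_eventually_sum_log_le {q a : ℕ} (hq : q ≠ 0) (ha : a.Coprime q) {ε : ℝ}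
    (h : ∀ᶠ n : ℕ in atTop, ∑ p ∈ n.primesLE with p ≡ a [MOD q], Real.log p ≤ ε * n) :
    (q.totient : ℝ)⁻¹ ≤ ε := by
  classical
  have : NeZero q := ⟨hq⟩
  set g : ℕ → ℝ := fun n => if n.Prime then residueClass (a : ZMod q) n else 0 with hg
  set g' : ℕ → ℝ := fun n => if n.Prime then 0 else residueClass (a : ZMod q) n with hg'
  have hres0 : ∀ n, 0 ≤ residueClass (a : ZMod q) n := residueClass_nonneg _
  have hg0 : ∀ n, 0 ≤ g n := fun n => by
    simp only [hg]; split_ifs; exacts [hres0 n, le_rfl]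
  have hg'0 : ∀ n, 0 ≤ g' n := fun n => by
    simp only [hg']; split_ifs; exacts [le_rfl, hres0 n]
  have hgg' : ∀ n, residueClass (a : ZMod q) n = g' n + g n := fun n => by
    simp only [hg, hg']; split_ifs <;> simp
  have hsumg : ∀ n : ℕ, ∑ k ∈ Finset.range n, g (k + 1) =
      ∑ p ∈ n.primesLE with p ≡ a [MOD q], Real.log p := by
    intro n
    have h1 : ∑ k ∈ Finset.range n, g (k + 1) = ∑ k ∈ Finset.range (n + 1), g k := by
      rw [Finset.sum_range_succ', show g 0 = 0 by simp [hg], add_zero]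
    rw [h1, Finset.sum_filter]
    have h2 : n.primesLE = (Finset.range (n + 1)).filter Nat.Prime := by
      ext p
      simp [Nat.mem_primesLE]
    rw [h2, Finset.sum_filter]
    refine Finset.sum_congr rfl fun k _ => ?_
    simp only [hg, residueClass, Set.indicator_apply, Set.mem_ofPred_eq,
      ZMod.natCast_eq_natCast_iff]
    split_ifs with h3 h4
    exacts [ArithmeticFunction.vonMangoldt_apply_prime h3, rfl, rfl]
  obtain ⟨n₀, hn₀⟩ := eventually_atTop.1 h
  have hε : 0 ≤ ε := by
    have h1 := hn₀ (n₀ + 1) (by omega)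
    rw [← hsumg] at h1
    have h2 : 0 ≤ ε * ((n₀ + 1 : ℕ) : ℝ) := (Finset.sum_nonneg fun k _ => hg0 (k + 1)).trans h1
    exact nonneg_of_mul_nonneg_left h2 (by positivity)
  set C := ∑ k ∈ Finset.range n₀, g (k + 1) with hC
  have hC0 : 0 ≤ C := Finset.sum_nonneg fun k _ => hg0 (k + 1)
  have hpart : ∀ n : ℕ, ∑ k ∈ Finset.range n, g (k + 1) ≤ ε * n + C := by
    intro n
    rcases le_total n₀ n with hn | hn
    · have := hn₀ n hn
      rw [← hsumg] at this
      linarith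
    · have h1 : ∑ k ∈ Finset.range n, g (k + 1) ≤ C :=
        Finset.sum_le_sum_of_subset_of_nonneg (Finset.range_mono hn) fun k _ _ => hg0 (k + 1)
      have : 0 ≤ ε * n := by positivity
      linarith
  have hunit : IsUnit (a : ZMod q) := (ZMod.isUnit_iff_coprime a q).2 ha
  obtain ⟨C₁, hC₁⟩ := LSeries_residueClass_lower_bound hunit
  have hsummable : Summable fun n : ℕ => g' n / n := summable_residueClass_non_primes_div _
  set C₂ := ∑' n : ℕ, g' n / n with hC₂
  have hbound : ∀ s ∈ Set.Ioc (1 : ℝ) 2, ∑' n : ℕ, residueClass (a : ZMod q) n / (n : ℝ) ^ s ≤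
      C₂ + (ε * ∑' n : ℕ, 1 / (n : ℝ) ^ s + C) := by
    intro s hs
    have hs0 : 0 < s := by linarith [hs.1]
    refine Real.tsum_le_of_sum_range_le (fun n => by have := hres0 n; positivity) fun n => ?_
    simp_rw [hgg', add_div, Finset.sum_add_distrib]
    refine add_le_add ?_ ?_
    · calc ∑ k ∈ Finset.range n, g' k / (k : ℝ) ^ s ≤ ∑ k ∈ Finset.range n, g' k / (k : ℝ) := by
            refine Finset.sum_le_sum fun k _ => ?_
            rcases Nat.eq_zero_or_pos k with rfl | hk
            · simp [Real.zero_rpow hs0.ne']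
            · have hk1 : (1 : ℝ) ≤ k := by exact_mod_cast hk
              have := hg'0 k
              gcongr
              exact Real.self_le_rpow_of_one_le hk1 hs.1.le
        _ ≤ C₂ := hsummable.sum_le_tsum _ fun k _ => div_nonneg (hg'0 k) (Nat.cast_nonneg k)
    · have hanti : Antitone fun k : ℕ => 1 / ((k + 1 : ℕ) : ℝ) ^ s := by
        intro i j hij
        dsimp only
        gcongr
      have h1 := sum_range_mul_le_of_antitone hanti (fun k => by positivity) hpart n
      have h2 : ∑ k ∈ Finset.range n, 1 / ((k + 1 : ℕ) : ℝ) ^ s ≤ ∑' n : ℕ, 1 / (n : ℝ) ^ s := by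
        have h3 := (Real.summable_one_div_nat_rpow.2 hs.1).sum_le_tsum (Finset.range (n + 1))
          fun k _ => by positivity
        rw [Finset.sum_range_succ'] at h3
        have h4 : 0 ≤ 1 / ((0 : ℕ) : ℝ) ^ s := by positivity
        linarith
      calc ∑ k ∈ Finset.range n, g k / (k : ℝ) ^ s
          ≤ ∑ k ∈ Finset.range (n + 1), g k / (k : ℝ) ^ s :=
            Finset.sum_le_sum_of_subset_of_nonneg (Finset.range_mono n.le_succ)
              fun k _ _ => by have := hg0 k; positivity
        _ = ∑ k ∈ Finset.range n, g (k + 1) * (1 / ((k + 1 : ℕ) : ℝ) ^ s) := by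
            rw [Finset.sum_range_succ', show g 0 = 0 by simp [hg], zero_div, add_zero]
            exact Finset.sum_congr rfl fun k _ => by ring
        _ ≤ _ := h1
        _ ≤ _ := by
            simp only [zero_add, Nat.cast_one, Real.one_rpow, div_one, mul_one]
            gcongr
  have hlim : Tendsto (fun s : ℝ => (s - 1) * (C₂ + C + C₁) +
      ε * ((s - 1) * ∑' n : ℕ, 1 / (n : ℝ) ^ s)) (𝓝[>] 1) (𝓝 ((1 - 1) * (C₂ + C + C₁) + ε * 1)) := by
    refine Tendsto.add (Tendsto.mul_const _ ?_) (tendsto_sub_mul_tsum_nat_rpow.const_mul _)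
    exact tendsto_nhdsWithin_of_tendsto_nhds ((continuous_id.sub continuous_const).tendsto 1)
  rw [sub_self, zero_mul, zero_add, mul_one] at hlim
  refine ge_of_tendsto hlim ?_
  filter_upwards [Ioc_mem_nhdsGT (show (1 : ℝ) < 2 by norm_num)] with s hs
  have hs1 : 0 < s - 1 := by linarith [hs.1]
  have h1 := (hC₁ hs).trans (hbound s hs)
  have h2 := mul_le_mul_of_nonneg_left h1 hs1.le
  rw [mul_sub, mul_div_cancel₀ _ hs1.ne'] at h2
  linarith

theorem log_le_div_add_of_pos {u : ℝ} (hu : 0 < u) : Real.log u ≤ u / 256 + 4.5452 := by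
  have h := Real.log_le_sub_one_of_pos (show 0 < u / 256 by positivity)
  rw [Real.log_div hu.ne' (by norm_num), show (256 : ℝ) = 2 ^ 8 by norm_num, Real.log_pow] at h
  push_cast at h
  rw [show (256 : ℝ) = 2 ^ 8 by norm_num]
  linarith [Real.log_two_lt_d9]

theorem exists_prime_forall_not_leastPow_dvd_add {q : ℕ} (hq : 2 ^ 16 ≤ q) :
    ∃ s < q, s.Prime ∧ s ≠ 2 ∧ ∀ r, 2 ≤ r → ¬ leastPow (2 ^ 16) r ∣ q + s - 2 := by
  by_contra! hcon
  have hY : ∀ r s, 2 ≤ r → s < q → s.Prime → leastPow (2 ^ 16) r ∣ q + s - 2 →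
      leastPow (2 ^ 16) r ≤ 2 * q ∧ r ≤ (2 * q).sqrt := by
    intro r s hr hs hsp hdvd
    have h2 := hsp.two_le
    have h1 := Nat.le_of_dvd (by omega) hdvd
    refine ⟨by omega, Nat.le_sqrt'.2 ((sq_le_leastPow (N := 2 ^ 16) hr).trans (by omega))⟩
  have hD := sum_log_primes_le_of_leastPow (N := 2 ^ 16) (R := 256) (M := 1) (x := q)
    (Y := (2 * q).sqrt) (Z := 2 * q) (by norm_num) (by norm_num) one_pos
    (fun r s => leastPow (2 ^ 16) r ∣ q + s - 2) ((q - 1).primesLE.erase 2)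
    (fun s hs => by
      obtain ⟨h1, h2⟩ := Nat.mem_primesLE.1 (Finset.mem_of_mem_erase hs)
      have h3 := h2.two_le
      obtain ⟨r, hr, hdvd⟩ := hcon s (by omega) h2 (Finset.ne_of_mem_erase hs)
      exact ⟨h2, by omega, r, Finset.mem_Icc.2 ⟨hr, (hY r s hr (by omega) h2 hdvd).2⟩, hdvd⟩)
    (fun r hr s hs hdvd => by
      obtain ⟨h1, h2⟩ := Nat.mem_primesLE.1 (Finset.mem_of_mem_erase hs)
      have h3 := h2.two_le
      rw [mul_one]
      exact (hY r s (Finset.mem_Icc.1 hr).1 (by omega) h2 hdvd).1)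
    (fun r hr s hs t ht hsd htd => by
      rw [mul_one]
      have h2 := (Nat.mem_primesLE.1 (Finset.mem_of_mem_erase hs)).2.two_le
      have h3 := (Nat.mem_primesLE.1 (Finset.mem_of_mem_erase ht)).2.two_le
      have h4 : (q - 2) + s ≡ (q - 2) + t [MOD leastPow (2 ^ 16) r] := by
        rw [show q - 2 + s = q + s - 2 by omega, show q - 2 + t = q + t - 2 by omega]
        exact ((Nat.modEq_zero_iff_dvd).2 hsd).trans ((Nat.modEq_zero_iff_dvd).2 htd).symm
      exact Nat.ModEq.add_left_cancel' _ h4)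
  have hq0 : (65536 : ℝ) ≤ q := by exact_mod_cast hq
  have htheta : Chebyshev.theta q ≤
      ∑ p ∈ (q - 1).primesLE.erase 2, Real.log p + Real.log 2 + Real.log q := by
    rw [Chebyshev.theta_eq_sum_primesLE_log]
    have hsub : q.primesLE ⊆ insert q (q - 1).primesLE := by
      intro p hp
      rw [Finset.mem_insert, Nat.mem_primesLE]
      obtain ⟨h1, h2⟩ := Nat.mem_primesLE.1 hp
      by_cases h : p = q
      · exact Or.inl h
      · exact Or.inr ⟨by omega, h2⟩
    have hnot : q ∉ (q - 1).primesLE := by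
      rw [Nat.mem_primesLE]
      omega
    refine (Finset.sum_le_sum_of_subset_of_nonneg hsub
      fun p _ _ => Real.log_natCast_nonneg p).trans ?_
    have h2 : 2 ∈ (q - 1).primesLE := Nat.mem_primesLE.2 ⟨by omega, Nat.prime_two⟩
    rw [Finset.sum_insert hnot, ← Finset.add_sum_erase _ _ h2]
    push_cast
    linarith
  have hge := Chebyshev.theta_ge q
  set u := √(q : ℝ) with hu
  have huq : u ^ 2 = q := Real.sq_sqrt (by linarith)
  have hu256 : 256 ≤ u := by
    rw [hu]
    exact Real.le_sqrt_of_sq_le (by linarith)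
  have hlogq : Real.log q = 2 * Real.log u := by rw [← huq, Real.log_pow]; norm_num
  have hlog2q : Real.log ((2 * q : ℕ) : ℝ) = Real.log 2 + 2 * Real.log u := by
    push_cast
    rw [Real.log_mul (by norm_num) (by linarith), hlogq]
  have hlogq1 : Real.log (q + 1) ≤ Real.log 2 + 2 * Real.log u := by
    rw [← hlog2q]
    push_cast
    exact Real.log_le_log (by linarith) (by linarith)
  have hsqrt : ((2 * q).sqrt : ℝ) ≤ 1.5 * u := by
    refine abs_le_of_sq_le_sq' ?_ (by positivity) |>.2
    have h : ((2 * q).sqrt : ℝ) ^ 2 ≤ 2 * q := by exact_mod_cast Nat.sqrt_le' (2 * q)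
    nlinarith
  have hl0 : 0 ≤ Real.log u := Real.log_nonneg (by linarith)
  have hl : Real.log u ≤ 0.022 * u := by
    linarith [log_le_div_add_of_pos (show 0 < u by linarith)]
  have h256 : Real.log ((256 : ℕ) : ℝ) = 8 * Real.log 2 := by
    rw [show ((256 : ℕ) : ℝ) = 2 ^ 8 by norm_num, Real.log_pow]; norm_num
  have h4 : Real.log 4 = 2 * Real.log 2 := by
    rw [show (4 : ℝ) = 2 ^ 2 by norm_num, Real.log_pow]; norm_num
  rw [hlog2q, h256, h4] at hD
  rw [hlogq] at htheta
  simp only [Nat.cast_one, div_one, Real.log_one, mul_zero, add_zero, mul_one] at hD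
  rw [← huq] at hD
  push_cast at hD
  have hl2 := Real.log_two_gt_d9
  have hl2' := Real.log_two_lt_d9
  have hY' : 2 * ((2 * q).sqrt : ℝ) * (Real.log 2 + 2 * Real.log u) ≤
      2 * (1.5 * u) * (0.7 + 2 * (0.022 * u)) := by
    gcongr
    linarith
  have hul : u * Real.log u ≤ u * (0.022 * u) := by gcongr
  have hul2 : u ^ 2 * 0.693 ≤ u ^ 2 * Real.log 2 := by
    gcongr
    linarith
  have hul3 : u ^ 2 * ((8 * (8 * Real.log 2) + 4) / 256) ≤ u ^ 2 * 0.19 := by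
    gcongr
    linarith
  have hul4 : 2 * Real.log 2 * (u ^ 2 / 2 ^ 16 + 1) ≤ 1.4 * (u ^ 2 / 2 ^ 16 + 1) := by
    gcongr
    linarith
  have hu2 : 256 * u ≤ u ^ 2 := by nlinarith
  nlinarith

open Filter in
theorem eventually_sqrt_mul_log_le {M : ℕ} (hM : 0 < M) :
    ∀ᶠ n : ℕ in atTop, 2 * ((n + 1).sqrt : ℝ) * Real.log (((n + 1) * M : ℕ) : ℝ) + Real.log 4 ≤
      n / (4 * M) := by
  have hM0 : (0 : ℝ) < M := by exact_mod_cast hM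
  have hδ : 0 < 1 / (32 * M * √(M : ℝ)) := by positivity
  have h1 := (isLittleO_log_rpow_atTop (show (0 : ℝ) < 1 / 2 by norm_num)).bound hδ
  have htend : Tendsto (fun n : ℕ => (((n + 1) * M : ℕ) : ℝ)) atTop atTop := by
    refine tendsto_natCast_atTop_atTop.comp (tendsto_atTop_mono (f := fun n => n) ?_ tendsto_id)
    intro n
    nlinarith
  filter_upwards [htend.eventually h1, eventually_ge_atTop (8 * M * 2), eventually_ge_atTop 1]
    with n hn hn2 hn1
  have hn1' : (1 : ℝ) ≤ n := by exact_mod_cast hn1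
  have hn2' : (8 * M * 2 : ℝ) ≤ n := by exact_mod_cast hn2
  rw [← Real.sqrt_eq_rpow, Real.norm_of_nonneg (Real.sqrt_nonneg _)] at hn
  have hn' := (Real.le_norm_self _).trans hn
  have hs : √(((n + 1) * M : ℕ) : ℝ) = √((n : ℝ) + 1) * √(M : ℝ) := by
    push_cast
    rw [Real.sqrt_mul (by positivity)]
  have hs2 : ((n + 1).sqrt : ℝ) ≤ √((n : ℝ) + 1) := by
    have := Real.nat_sqrt_le_real_sqrt (a := n + 1)
    push_cast at this
    exact this
  have hlog4 : Real.log 4 ≤ 2 := by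
    rw [show (4 : ℝ) = 2 ^ 2 by norm_num, Real.log_pow]
    push_cast
    linarith [Real.log_two_lt_d9]
  have hlog4' : Real.log 4 ≤ n / (8 * M) := by
    refine hlog4.trans ?_
    rw [le_div_iff₀ (by positivity)]
    linarith
  have hmain : 2 * ((n + 1).sqrt : ℝ) * Real.log (((n + 1) * M : ℕ) : ℝ) ≤ n / (8 * M) := by
    calc _ ≤ 2 * √((n : ℝ) + 1) * (1 / (32 * M * √(M : ℝ)) * (√((n : ℝ) + 1) * √(M : ℝ))) := by
          rw [hs] at hn'
          have := Real.log_natCast_nonneg ((n + 1) * M)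
          gcongr
      _ = (√((n : ℝ) + 1)) ^ 2 / (16 * M) := by
          have : 0 < √(M : ℝ) := Real.sqrt_pos.2 hM0
          field_simp
          ring
      _ = (n + 1) / (16 * M) := by rw [Real.sq_sqrt (by positivity)]
      _ ≤ n / (8 * M) := by
          rw [div_le_div_iff₀ (by positivity) (by positivity)]
          nlinarith
  have : (n : ℝ) / (4 * M) = n / (8 * M) + n / (8 * M) := by ring
  linarith

theorem sieve_constant_le {N M : ℕ} (hN : 2 ^ 16 ≤ N) (hM : 0 < M) (hMN : M ^ 2 ≤ N ^ 3) :
    (8 * Real.log N.sqrt + 4 + 4 * Real.log M) / N.sqrt + Real.log 4 / N ≤ 1 / 2 := by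
  set R := N.sqrt with hR
  have hR256 : 256 ≤ R := Nat.le_sqrt'.2 (by omega)
  have hR' : (256 : ℝ) ≤ R := by exact_mod_cast hR256
  have hN' : (65536 : ℝ) ≤ N := by exact_mod_cast hN
  have hM' : (0 : ℝ) < M := by exact_mod_cast hM
  have hlogM : 2 * Real.log M ≤ 3 * Real.log N := by
    have h : Real.log ((M : ℝ) ^ 2) ≤ Real.log ((N : ℝ) ^ 3) :=
      Real.log_le_log (by positivity) (by exact_mod_cast hMN)
    rw [Real.log_pow, Real.log_pow] at h
    exact_mod_cast h
  have hlogN : Real.log N ≤ 2 * Real.log (R + 1) := by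
    have h : Real.log N ≤ Real.log (((R : ℝ) + 1) ^ 2) :=
      Real.log_le_log (by linarith) (by exact_mod_cast (Nat.lt_succ_sqrt' N).le)
    rw [Real.log_pow] at h
    exact_mod_cast h
  have hlogR1 : Real.log (R + 1) ≤ (R + 1) / 256 + 4.5452 := log_le_div_add_of_pos (by linarith)
  have hlogR : Real.log R ≤ R / 256 + 4.5452 := log_le_div_add_of_pos (by linarith)
  have hlog4 : Real.log 4 ≤ 2 := by
    rw [show (4 : ℝ) = 2 ^ 2 by norm_num, Real.log_pow]
    push_cast
    linarith [Real.log_two_lt_d9]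
  have h1 : (8 * Real.log R + 4 + 4 * Real.log M) / R ≤ 0.49 := by
    rw [div_le_iff₀ (by linarith)]
    linarith
  have h2 : Real.log 4 / N ≤ 0.01 := by
    rw [div_le_iff₀ (by linarith)]
    linarith
  linarith

open Filter in
theorem exists_prime_modEq_forall_not_leastPow_dvd_add_one {N r₀ k : ℕ} (hr₀ : r₀.Prime)
    (hk : 2 ≤ k) (hNk : N = r₀ ^ k) (hN : 2 ^ 16 ≤ N) :
    ∃ p, p.Prime ∧ p ≡ N - 1 [MOD N * r₀] ∧
      ∀ r, r.Prime → r ≠ r₀ → ¬ leastPow N r ∣ p + 1 := by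
  by_contra! hcon
  set M := N * r₀ with hM
  have hN0 : 0 < N := by omega
  have hM0 : 0 < M := Nat.mul_pos hN0 hr₀.pos
  have hMN : M ^ 2 ≤ N ^ 3 := by
    have h : r₀ ^ 2 ≤ N := hNk ▸ Nat.pow_le_pow_right hr₀.pos hk
    calc M ^ 2 = N ^ 2 * r₀ ^ 2 := by rw [hM]; ring
      _ ≤ N ^ 2 * N := Nat.mul_le_mul_left _ h
      _ = N ^ 3 := by ring
  have hcopN : (N - 1).Coprime N := by
    have := Nat.coprime_self_add_right (m := N - 1) (n := 1)
    rw [show N - 1 + 1 = N by omega] at this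
    exact this.2 (Nat.coprime_one_right _)
  have hcop : (N - 1).Coprime M :=
    hcopN.mul_right (hcopN.coprime_dvd_right (hNk ▸ dvd_pow_self r₀ (by omega)))
  have hcopM : ∀ r, r.Prime → r ≠ r₀ → (leastPow N r).Coprime M := by
    intro r hr hne
    have h : r.Coprime r₀ := (Nat.coprime_primes hr hr₀).2 hne
    rw [hM, hNk]
    exact Nat.Coprime.pow_left _ ((h.pow_right k).mul_right h)
  have hev : ∀ᶠ n : ℕ in atTop, ∑ p ∈ n.primesLE with p ≡ N - 1 [MOD M], Real.log p ≤
      3 / (4 * M) * n := by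
    filter_upwards [eventually_sqrt_mul_log_le hM0] with n hn
    have hdn : ∀ r p, p ≤ n → leastPow N r ∣ p + 1 → leastPow N r ≤ n + 1 := fun r p hp hdvd =>
      (Nat.le_of_dvd p.succ_pos hdvd).trans (by omega)
    have hD := sum_log_primes_le_of_leastPow (N := N) (R := N.sqrt) (M := M) (x := n)
      (Y := (n + 1).sqrt) (Z := (n + 1) * M) (Nat.le_sqrt'.2 (by omega)) (Nat.sqrt_le' N) hM0
      (fun r p => r.Prime ∧ r ≠ r₀ ∧ leastPow N r ∣ p + 1)
      {p ∈ n.primesLE | p ≡ N - 1 [MOD M]}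
      (fun p hp => by
        obtain ⟨hp1, hp2⟩ := Finset.mem_filter.1 hp
        obtain ⟨hp3, hp4⟩ := Nat.mem_primesLE.1 hp1
        obtain ⟨r, hr, hne, hdvd⟩ := hcon p hp4 hp2
        exact ⟨hp4, hp3, r, Finset.mem_Icc.2 ⟨hr.two_le, Nat.le_sqrt'.2
          ((sq_le_leastPow hr.two_le).trans (hdn r p hp3 hdvd))⟩, hr, hne, hdvd⟩)
      (fun r _ p hp h => Nat.mul_le_mul_right M
        (hdn r p (Nat.mem_primesLE.1 (Finset.mem_filter.1 hp).1).1 h.2.2))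
      (fun r _ p hp p' hp' h h' => by
        rw [← Nat.modEq_and_modEq_iff_modEq_mul (hcopM r h.1 h.2.1)]
        refine ⟨Nat.ModEq.add_right_cancel' 1 (((Nat.modEq_zero_iff_dvd).2 h.2.2).trans
          ((Nat.modEq_zero_iff_dvd).2 h'.2.2).symm), ?_⟩
        exact (Finset.mem_filter.1 hp).2.trans (Finset.mem_filter.1 hp').2.symm)
    have hc := sieve_constant_le hN hM0 hMN
    have hM0' : (0 : ℝ) < M := by exact_mod_cast hM0
    have hN0' : (0 : ℝ) < N := by exact_mod_cast hN0
    have h1 := mul_le_mul_of_nonneg_left hc (show 0 ≤ (n : ℝ) / M by positivity)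
    have h2 : Real.log 4 * ((n : ℝ) / (N * M) + 1) =
        n / M * (Real.log 4 / N) + Real.log 4 := by
      field_simp
    have h3 : 3 / (4 * (M : ℝ)) * n = n / M * (1 / 2) + n / (4 * M) := by
      field_simp
      ring
    rw [h2] at hD
    rw [h3]
    linarith
  have hdens := inv_totient_le_of_eventually_sum_log_le hM0.ne' hcop hev
  have hM0' : (0 : ℝ) < M := by exact_mod_cast hM0
  have htot : (M : ℝ)⁻¹ ≤ (M.totient : ℝ)⁻¹ := by
    have h1 : (0 : ℝ) < M.totient := by exact_mod_cast Nat.totient_pos.2 hM0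
    have h2 : (M.totient : ℝ) ≤ M := by exact_mod_cast Nat.totient_le M
    gcongr
  have h4 : 3 / (4 * (M : ℝ)) = 3 / 4 * (M : ℝ)⁻¹ := by
    field_simp
  rw [h4] at hdens
  have h5 : 0 < (M : ℝ)⁻¹ := by positivity
  linarith

/-- `noDivisorFrom n fuel d` checks that no `e` with `d ≤ e` and `e * e ≤ n` divides `n`. -/
def noDivisorFrom (n : ℕ) : ℕ → ℕ → Bool
  | 0, _ => false
  | fuel + 1, d => Nat.blt n (d * d) || (Nat.blt 0 (n % d) && noDivisorFrom n fuel (d + 1))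

theorem not_dvd_of_noDivisorFrom {n fuel d : ℕ} (h : noDivisorFrom n fuel d = true) {e : ℕ}
    (hde : d ≤ e) (hen : e * e ≤ n) : ¬ e ∣ n := by
  induction fuel generalizing d with
  | zero => simp [noDivisorFrom] at h
  | succ fuel ih =>
    simp only [noDivisorFrom, Bool.or_eq_true, Bool.and_eq_true, Nat.blt_eq] at h
    rcases h with h | ⟨h, hrec⟩
    · exact absurd h (not_lt.2 ((Nat.mul_le_mul hde hde).trans hen))
    · rcases hde.eq_or_lt with rfl | hlt
      · rw [Nat.dvd_iff_mod_eq_zero]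
        exact h.ne'
      · exact ih hrec hlt

/-- A trial division primality test that is complete below `2 ^ 18`. -/
def isPrimeByTrial (n : ℕ) : Bool := Nat.blt 1 n && noDivisorFrom n 512 2

theorem Nat.Prime.of_isPrimeByTrial {n : ℕ} (h : isPrimeByTrial n = true) : n.Prime := by
  simp only [isPrimeByTrial, Bool.and_eq_true, Nat.blt_eq] at h
  exact Nat.prime_def_le_sqrt.2 ⟨h.1, fun m hm hms =>
    not_dvd_of_noDivisorFrom h.2 hm (Nat.le_sqrt.1 hms)⟩

/-- `hasGoldbachPair c B E` searches for primes `a ≥ c` and `b` with `a < B` and `a + b = E`. -/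
def hasGoldbachPair (c B E : ℕ) : Bool :=
  (List.range 512).any fun a => Nat.ble c a && (Nat.blt a B && (isPrimeByTrial a &&
    isPrimeByTrial (E - a)))

theorem exists_primes_of_hasGoldbachPair {c B E : ℕ} (h : hasGoldbachPair c B E = true) :
    ∃ a b, a.Prime ∧ b.Prime ∧ c ≤ a ∧ a < B ∧ a + b = E := by
  simp only [hasGoldbachPair, List.any_eq_true, Bool.and_eq_true, Nat.blt_eq, Nat.ble_eq] at h
  obtain ⟨a, -, hca, haB, ha, hb⟩ := h
  have hb' := Nat.Prime.of_isPrimeByTrial hb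
  exact ⟨a, E - a, .of_isPrimeByTrial ha, hb', hca, haB, by have := hb'.pos; omega⟩

theorem hasGoldbachPair_two_pow :
    ((List.range 17).all fun k => Nat.blt k 2 || hasGoldbachPair 3 (2 ^ k) (2 ^ k + 2)) = true := by
  decide +kernel

theorem hasGoldbachPair_odd_pow :
    ((List.range 256).all fun r => (Nat.blt r 2 || Nat.beq (r % 2) 0) ||
      (List.range 16).all fun k => (Nat.blt k 2 || Nat.ble (2 ^ 16) (r ^ k)) ||
        hasGoldbachPair 7 (r ^ k) (2 * r ^ k + 2)) = true := by
  decide +kernel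

theorem exists_primes_add_eq_two_pow_add_two {k : ℕ} (hk : 2 ≤ k) (hk' : k ≤ 16) :
    ∃ a b, a.Prime ∧ b.Prime ∧ a < 2 ^ k ∧ b < 2 ^ k ∧ a + b = 2 ^ k + 2 := by
  have h := List.all_eq_true.1 hasGoldbachPair_two_pow k (List.mem_range.2 (by omega))
  simp only [Bool.or_eq_true, Nat.blt_eq, not_lt.2 hk, false_or] at h
  obtain ⟨a, b, ha, hb, h3, haB, hab⟩ := exists_primes_of_hasGoldbachPair h
  exact ⟨a, b, ha, hb, haB, by omega, hab⟩

theorem exists_primes_add_eq_two_mul_pow_add_two {r k : ℕ} (hr : 2 ≤ r) (hr2 : r % 2 ≠ 0)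
    (hk : 2 ≤ k) (hlt : r ^ k < 2 ^ 16) :
    ∃ a b, a.Prime ∧ b.Prime ∧ 7 ≤ a ∧ a < r ^ k ∧ a + b = 2 * r ^ k + 2 := by
  have hr' : r < 256 := lt_of_pow_lt_pow_left₀ 2 (by norm_num)
    ((Nat.pow_le_pow_right (by omega) hk).trans_lt (by simpa using hlt))
  have hk' : k < 16 := (Nat.pow_lt_pow_iff_right (a := 2) (by norm_num)).1
    ((Nat.pow_le_pow_left hr k).trans_lt hlt)
  have h := List.all_eq_true.1 hasGoldbachPair_odd_pow r (List.mem_range.2 hr')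
  simp only [Bool.or_eq_true, Nat.blt_eq, Nat.beq_eq, not_lt.2 hr, hr2, false_or] at h
  have h := List.all_eq_true.1 h k (List.mem_range.2 hk')
  simp only [Bool.or_eq_true, Nat.blt_eq, Nat.ble_eq, not_lt.2 hk, not_le.2 hlt, false_or] at h
  exact exists_primes_of_hasGoldbachPair h

/-- A multiplicative function with `f 2 = 2` and `f (p + q - 2) = f p + f q - f 2` on primes. -/
structure IsAdditiveOnShiftedPrimes (f : ℕ → ℂ) : Prop where
  map_one : f 1 = 1
  map_mul : ∀ m n : ℕ, Nat.Coprime m n → f (m * n) = f m * f n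
  map_add_sub : ∀ p q : ℕ, p.Prime → q.Prime → f (p + q - 2) = f p + f q - f 2
  map_two : f 2 = 2

namespace IsAdditiveOnShiftedPrimes

variable {f : ℕ → ℂ}

theorem map_of_map_primePow (hf : IsAdditiveOnShiftedPrimes f) {n : ℕ} (hn : n ≠ 0)
    (h : ∀ r, r.Prime → r ∣ n → f (r ^ n.factorization r) = (r ^ n.factorization r : ℕ)) :
    f n = n := by
  rw [Nat.multiplicative_factorization f hf.map_mul hf.map_one hn]
  conv_rhs => rw [← Nat.prod_factorization_pow_eq_self hn]
  rw [Finsupp.prod, Finsupp.prod, Nat.cast_prod]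
  refine Finset.prod_congr rfl fun r hr => ?_
  rw [Nat.support_factorization, Nat.mem_primeFactors] at hr
  exact h r hr.1 hr.2.1

theorem map_of_not_isPrimePow (hf : IsAdditiveOnShiftedPrimes f) {n : ℕ} (hn : n ≠ 0)
    (hpp : ¬ IsPrimePow n) (h : ∀ m < n, 0 < m → f m = m) : f n = n := by
  refine hf.map_of_map_primePow hn fun r hr hrn => h _ ?_ (Nat.pow_pos hr.pos)
  refine lt_of_le_of_ne (Nat.le_of_dvd (by omega) (Nat.ordProj_dvd n r)) fun he => hpp ?_
  rw [← he]
  exact hr.isPrimePow.pow (hr.factorization_pos_of_dvd hn hrn).ne'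

theorem map_three (hf : IsAdditiveOnShiftedPrimes f) : f 3 = 3 := by
  have p3 := Nat.prime_three
  have p5 := Nat.prime_five
  have p7 : Nat.Prime 7 := by norm_num
  have p11 : Nat.Prime 11 := by norm_num
  have h4 := hf.map_add_sub 3 3 p3 p3
  have h6 := hf.map_add_sub 3 5 p3 p5
  have h8 := hf.map_add_sub 5 5 p5 p5
  have h8' := hf.map_add_sub 3 7 p3 p7
  have h12 := hf.map_add_sub 7 7 p7 p7
  have h12' := hf.map_add_sub 3 11 p3 p11
  have h20 := hf.map_add_sub 11 11 p11 p11
  have m6 := hf.map_mul 2 3 (by norm_num)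
  have m12 := hf.map_mul 3 4 (by norm_num)
  have m20 := hf.map_mul 4 5 (by norm_num)
  norm_num [hf.map_two] at h4 h6 h8 h8' h12 h12' h20 m6 m12 m20
  have e5 : f 5 = f 3 + 2 := by linear_combination m6 - h6
  have e7 : f 7 = f 3 + 4 := by linear_combination h8 - h8' + 2 * e5
  have e11 : f 11 = f 3 + 8 := by linear_combination h12 - h12' + 2 * e7
  have q12 : (f 3 - 3) * (f 3 + 1) = 0 := by
    linear_combination (h12 - m12 + 2 * e7 - f 3 * h4) / 2
  have q20 : (f 3 - 3) * (f 3 + 3) = 0 := by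
    linear_combination (h20 - m20 + 2 * e11 - f 5 * h4 - (2 * f 3 - 2) * e5) / 2
  linear_combination (q20 - q12) / 2

theorem map_five (hf : IsAdditiveOnShiftedPrimes f) : f 5 = 5 := by
  have h := hf.map_add_sub 3 5 Nat.prime_three Nat.prime_five
  have h' := hf.map_mul 2 3 (by norm_num)
  norm_num [hf.map_two, hf.map_three] at h h'
  linear_combination h' - h

theorem map_two_mul (hf : IsAdditiveOnShiftedPrimes f) {n : ℕ} (hn : n % 2 = 1) :
    f (2 * n) = 2 * f n := by
  rw [hf.map_mul 2 n ((Nat.coprime_two_left).2 (Nat.odd_iff.2 hn)), hf.map_two]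

theorem map_prime_of_add_three_lt (hf : IsAdditiveOnShiftedPrimes f) {n p : ℕ} (hp : p.Prime)
    (hpn : p + 3 < 2 * n) (h : ∀ m < n, 0 < m → f m = m) : f p = p := by
  rcases hp.eq_two_or_odd with rfl | hodd
  · simpa using hf.map_two
  obtain h4 | h4 : p % 4 = 1 ∨ p % 4 = 3 := by omega
  · have h1 := hf.map_add_sub p 3 hp Nat.prime_three
    obtain ⟨m, hm⟩ : ∃ m, p + 1 = 2 * m := ⟨(p + 1) / 2, by omega⟩
    rw [show p + 3 - 2 = 2 * m by omega, hf.map_two_mul (by omega),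
      h m (by omega) (by omega), hf.map_three, hf.map_two] at h1
    have hm' : (p : ℂ) + 1 = 2 * m := by exact_mod_cast hm
    linear_combination -h1 - hm'
  · have h1 := hf.map_add_sub p 5 hp Nat.prime_five
    obtain ⟨m, hm⟩ : ∃ m, p + 3 = 2 * m := ⟨(p + 3) / 2, by omega⟩
    rw [show p + 5 - 2 = 2 * m by omega, hf.map_two_mul (by omega),
      h m (by omega) (by omega), hf.map_five, hf.map_two] at h1
    have hm' : (p : ℂ) + 3 = 2 * m := by exact_mod_cast hm
    linear_combination -h1 - hm'

theorem map_of_lt_two_pow_sixteen (hf : IsAdditiveOnShiftedPrimes f) {n : ℕ} (hn : 0 < n)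
    (hlt : n < 2 ^ 16) : f n = n := by
  induction n using Nat.strong_induction_on with
  | _ n ih =>
    have ih' : ∀ m < n, 0 < m → f m = m := fun m hm h0 => ih m hm h0 (hm.trans hlt)
    by_cases hpp : IsPrimePow n
    swap
    · exact hf.map_of_not_isPrimePow hn.ne' hpp ih'
    obtain ⟨r, k, hr, hk0, rfl⟩ := (isPrimePow_nat_iff n).1 hpp
    obtain rfl | hk : k = 1 ∨ 2 ≤ k := by omega
    · rw [pow_one] at *
      rcases lt_or_ge 3 r with h3 | h3
      · exact hf.map_prime_of_add_three_lt hr (by omega) ih'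
      · have := hr.two_le
        obtain rfl | rfl : r = 2 ∨ r = 3 := by omega
        · simpa using hf.map_two
        · simpa using hf.map_three
    rcases hr.eq_two_or_odd with rfl | hodd
    · have hk16 : k < 16 := (Nat.pow_lt_pow_iff_right (by norm_num)).1 hlt
      obtain ⟨a, b, ha, hb, ha', hb', hab⟩ := exists_primes_add_eq_two_pow_add_two hk hk16.le
      have h := hf.map_add_sub a b ha hb
      rw [show a + b - 2 = 2 ^ k by omega, ih' a ha' ha.pos, ih' b hb' hb.pos, hf.map_two] at h
      have hab' : (a : ℂ) + b = (2 ^ k : ℕ) + 2 := by exact_mod_cast hab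
      linear_combination h + hab'
    · obtain ⟨a, b, ha, hb, h7, ha', hab⟩ :=
        exists_primes_add_eq_two_mul_pow_add_two hr.two_le (by omega) hk hlt
      have h := hf.map_add_sub a b ha hb
      rw [show a + b - 2 = 2 * r ^ k by omega,
        hf.map_two_mul (Nat.odd_iff.1 ((Nat.odd_iff.2 hodd).pow)), ih' a ha' ha.pos,
        hf.map_prime_of_add_three_lt hb (by omega) ih', hf.map_two] at h
      have hab' : (a : ℂ) + b = 2 * (r ^ k : ℕ) + 2 := by exact_mod_cast hab
      linear_combination (h + hab') / 2

theorem map_prime (hf : IsAdditiveOnShiftedPrimes f) {q : ℕ} (hq : q.Prime) : f q = q := by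
  induction q using Nat.strong_induction_on with
  | _ q ih =>
    rcases lt_or_ge q (2 ^ 16) with hlt | hge
    · exact hf.map_of_lt_two_pow_sixteen hq.pos hlt
    obtain ⟨s, hsq, hs, hs2, hnd⟩ := exists_prime_forall_not_leastPow_dvd_add hge
    have hqodd := hq.eq_two_or_odd
    have hsodd := hs.eq_two_or_odd
    have hs0 := hs.two_le
    set E := q + s - 2 with hE
    have hfE : f E = E := by
      refine hf.map_of_map_primePow (by omega) fun r hr hrE => ?_
      have hv := hr.factorization_pos_of_dvd (by omega) hrE
      have hdvd := Nat.ordProj_dvd E r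
      set v := E.factorization r
      obtain hv1 | hv2 : v = 1 ∨ 2 ≤ v := by omega
      · rw [hv1, pow_one]
        refine ih r ?_ hr
        obtain ⟨c, hc⟩ := hrE
        rcases hr.eq_two_or_odd with rfl | hrodd
        · omega
        have hc0 : c ≠ 0 := by
          rintro rfl
          omega
        have hc1 : c ≠ 1 := by
          rintro rfl
          omega
        have : r * 2 ≤ r * c := Nat.mul_le_mul_left r (by omega)
        omega
      · refine hf.map_of_lt_two_pow_sixteen (Nat.pow_pos hr.pos) ?_
        by_contra! hN
        exact hnd r hr.two_le ((leastPow_dvd_pow hv2 hN).trans hdvd)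
    have h := hf.map_add_sub q s hq hs
    rw [← hE, hfE, ih s hsq hs, hf.map_two] at h
    have hE' : (E : ℂ) + 2 = q + s := by
      have : E + 2 = q + s := by omega
      exact_mod_cast this
    linear_combination hE' - h

theorem map_primePow (hf : IsAdditiveOnShiftedPrimes f) {r₀ k : ℕ} (hr₀ : r₀.Prime) (hk : 2 ≤ k)
    (hN : 2 ^ 16 ≤ r₀ ^ k) (h : ∀ m < r₀ ^ k, 0 < m → f m = m) : f (r₀ ^ k) = (r₀ ^ k : ℕ) := by
  obtain ⟨p, hp, hmod, hnd⟩ :=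
    exists_prime_modEq_forall_not_leastPow_dvd_add_one hr₀ hk rfl hN
  set N := r₀ ^ k with hNdef
  have hmod1 : p + 1 ≡ N [MOD N * r₀] := by
    have := hmod.add_right 1
    rwa [Nat.sub_add_cancel (by omega)] at this
  obtain ⟨m, hm⟩ : N ∣ p + 1 :=
    (hmod1.of_mul_right r₀).dvd_iff (dvd_refl N) |>.2 dvd_rfl
  have hm0 : m ≠ 0 := by
    rintro rfl
    omega
  have hr₀m : ¬ r₀ ∣ m := by
    rintro hdvd
    have h1 : N * r₀ ∣ N := (hmod1.dvd_iff dvd_rfl).1 (hm ▸ Nat.mul_dvd_mul_left N hdvd)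
    have h2 := Nat.le_of_dvd (by omega) h1
    have := hr₀.two_le
    nlinarith
  have hfm : f m = m := by
    refine hf.map_of_map_primePow hm0 fun r hr hrm => ?_
    have hv := hr.factorization_pos_of_dvd hm0 hrm
    have hdvd := Nat.ordProj_dvd m r
    set v := m.factorization r
    obtain hv1 | hv2 : v = 1 ∨ 2 ≤ v := by omega
    · rw [hv1, pow_one]
      exact hf.map_prime hr
    · refine h _ ?_ (Nat.pow_pos hr.pos)
      by_contra! hle
      refine hnd r hr (fun he => hr₀m (he ▸ hrm)) ((leastPow_dvd_pow hv2 hle).trans ?_)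
      exact hdvd.trans (hm ▸ dvd_mul_left m N)
  have h1 := hf.map_add_sub p 3 hp Nat.prime_three
  have hcop : N.Coprime m := Nat.Coprime.pow_left k ((Nat.Prime.coprime_iff_not_dvd hr₀).2 hr₀m)
  rw [show p + 3 - 2 = p + 1 by omega, hm, hf.map_mul N m hcop, hfm, hf.map_prime hp,
    hf.map_three, hf.map_two] at h1
  have hm' : (p : ℂ) + 1 = N * m := by exact_mod_cast hm
  have hm0' : (m : ℂ) ≠ 0 := by exact_mod_cast hm0
  refine mul_right_cancel₀ hm0' ?_
  linear_combination h1 + hm'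

theorem map_natCast (hf : IsAdditiveOnShiftedPrimes f) {n : ℕ} (hn : 0 < n) : f n = n := by
  induction n using Nat.strong_induction_on with
  | _ n ih =>
    by_cases hpp : IsPrimePow n
    swap
    · exact hf.map_of_not_isPrimePow hn.ne' hpp ih
    obtain ⟨r, k, hr, hk0, rfl⟩ := (isPrimePow_nat_iff n).1 hpp
    rcases lt_or_ge (r ^ k) (2 ^ 16) with hlt | hge
    · exact hf.map_of_lt_two_pow_sixteen hn hlt
    obtain rfl | hk : k = 1 ∨ 2 ≤ k := by omega
    · rw [pow_one]
      exact hf.map_prime hr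
    · exact hf.map_primePow hr hk hge ih

end IsAdditiveOnShiftedPrimes

theorem stmt_7 (f : ℕ → ℂ)
    (hf1 : f 1 = 1)
    (hmul : ∀ m n : ℕ, Nat.Coprime m n → f (m * n) = f m * f n)
    (heq : ∀ p q : ℕ, p.Prime → q.Prime → f (p + q - 2) = f p + f q - f 2)
    (hf2 : f 2 = 2) :
    ∀ n : ℕ, 0 < n → f n = (n : ℂ) :=
  fun _ hn => IsAdditiveOnShiftedPrimes.map_natCast ⟨hf1, hmul, heq, hf2⟩ hn
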